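/- (S,T-isomer comparison, Yang–Klein) Let S be a finite connected simple graph with an edge cut {ux, vy} (where u ≠ v and x ≠ y) whose deletion leaves exactly two connected components: A containing u and v, and B containing x and y. Let T be the graph obtained from S by deleting the edges ux and vy and adding the edges uy and vx. Then Kf(S) − Kf(T) = [r_A(u) − r_A(v)]·[r_B(y) − r_B(x)] / (r_A(u,v) + r_B(x,y) + 2), where all resistance quantities on the right-hand side are computed within the components A and B respectively. -/

import Mathlib

/-!  Common definitions: Moore–Penrose pseudoinverse, resistance distance and
Kirchhoff index of a simple graph (unit resistors), weighted electrical networks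
(given by a symmetric conductance function), multigraph electrical networks,
and the octagonal chains `O(w)`.  -/

/-- `M` is a Moore–Penrose pseudoinverse of `A`. -/
def Matrix.IsMoorePenroseInv {n : Type} [Fintype n] (A M : Matrix n n ℝ) : Prop :=
  A * M * A = A ∧ M * A * M = M ∧ (A * M).transpose = A * M ∧ (M * A).transpose = M * A

open Classical in
/-- The Moore–Penrose pseudoinverse of a real square matrix (it exists and is
unique; defined by choice). -/
noncomputable def mpinv {n : Type} [Fintype n] (A : Matrix n n ℝ) : Matrix n n ℝ :=
  if h : ∃ M, A.IsMoorePenroseInv M then h.choose else 0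

open Classical in
/-- The (real) Laplacian matrix of a simple graph: degree diagonal minus adjacency. -/
noncomputable def glap {V : Type} [Fintype V] (G : SimpleGraph V) : Matrix V V ℝ :=
  fun u v =>
    if u = v then ((Finset.univ.filter (fun t => G.Adj u t)).card : ℝ)
    else if G.Adj u v then -1 else 0

/-- Resistance distance `r_G(u,v) = (e_u - e_v)ᵀ L⁺ (e_u - e_v)` in a simple graph,
each edge being a unit resistor. -/
noncomputable def resDist {V : Type} [Fintype V] (G : SimpleGraph V) (u v : V) : ℝ :=
  mpinv (glap G) u u - mpinv (glap G) u v - mpinv (glap G) v u + mpinv (glap G) v v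

/-- `r_G(a)`: the sum of the resistance distances between `a` and all other vertices. -/
noncomputable def resSum {V : Type} [Fintype V] [DecidableEq V] (G : SimpleGraph V) (a : V) : ℝ :=
  ∑ b ∈ Finset.univ.erase a, resDist G a b

/-- The Kirchhoff index: the sum of resistance distances over all unordered pairs. -/
noncomputable def kirchhoff {V : Type} [Fintype V] (G : SimpleGraph V) : ℝ :=
  (∑ u, ∑ v, resDist G u v) / 2

/-- A weighted graph (electrical network) on `V`, recorded by its symmetric
conductance function: `cond u v` is the reciprocal of the resistance of the edge
`uv` (and `0` if there is no such edge). -/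
structure Network (V : Type) where
  cond : V → V → ℝ
  symm : ∀ u v, cond u v = cond v u
  nonneg : ∀ u v, 0 ≤ cond u v
  loopless : ∀ v, cond v v = 0

/-- The weighted Laplacian of a network. -/
noncomputable def Network.lap {V : Type} [Fintype V] [DecidableEq V] (N : Network V) :
    Matrix V V ℝ :=
  fun u v => if u = v then ∑ t, N.cond u t else -N.cond u v

/-- Effective resistance in a network, via the pseudoinverse of the weighted Laplacian. -/
noncomputable def Network.effRes {V : Type} [Fintype V] [DecidableEq V] (N : Network V)
    (u v : V) : ℝ :=
  mpinv N.lap u u - mpinv N.lap u v - mpinv N.lap v u + mpinv N.lap v v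

/-- The underlying simple graph of a network. -/
def Network.toGraph {V : Type} (N : Network V) : SimpleGraph V :=
  SimpleGraph.fromRel (fun u v => N.cond u v ≠ 0)

/-- An electrical network with multiple edges allowed: a finite edge type, each edge a
non-loop with two endpoints and a positive resistance. -/
structure MultiNetwork (V : Type) where
  E : Type
  [fE : Fintype E]
  ends : E → Sym2 V
  not_loop : ∀ e, ¬ (ends e).IsDiag
  res : E → ℝ
  res_pos : ∀ e, 0 < res e

attribute [instance] MultiNetwork.fE

/-- Total conductance between `u` and `v`: the sum, over all edges joining `u` and `v`,
of the reciprocals of their resistances. -/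
noncomputable def MultiNetwork.cond {V : Type} [DecidableEq V] (M : MultiNetwork V)
    (u v : V) : ℝ :=
  ∑ e ∈ Finset.univ.filter (fun e => M.ends e = s(u, v)), (M.res e)⁻¹

/-- The weighted Laplacian of a multigraph network. -/
noncomputable def MultiNetwork.lap {V : Type} [Fintype V] [DecidableEq V]
    (M : MultiNetwork V) : Matrix V V ℝ :=
  fun u v => if u = v then ∑ t, M.cond u t else -M.cond u v

/-- Effective resistance in a multigraph network. -/
noncomputable def MultiNetwork.effRes {V : Type} [Fintype V] [DecidableEq V]
    (M : MultiNetwork V) (u v : V) : ℝ :=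
  mpinv M.lap u u - mpinv M.lap u v - mpinv M.lap v u + mpinv M.lap v v

/-- The underlying simple graph of a multigraph network. -/
def MultiNetwork.toGraph {V : Type} (M : MultiNetwork V) : SimpleGraph V :=
  SimpleGraph.fromRel (fun u v => ∃ e, M.ends e = s(u, v))

/-!  The octagonal chain `O(w)` with `n` octagons, `w = (w_1, …, w_{n-2})`,
`w_i ∈ {0,1,2,3,4}`.  Its `6n+2` vertices are laid out along the outer boundary
cycle `0, 1, …, 6n+1`: position `0` is the top-left corner, the top boundary runs
rightwards (the top of the octagon `H_i`, `1 ≤ i ≤ n-2`, carries `w_i` inserted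
vertices), then the right vertical edge, then the bottom boundary runs leftwards
back to the bottom-left corner `6n+1`.  The graph is this outer cycle together
with the `n-1` chords `t_k b_k` shared by consecutive octagons. -/

/-- Boundary position of the top vertex `t_k` (`1 ≤ k ≤ n-1`) of the `k`-th shared
vertical edge: `t_k = k + w_1 + ⋯ + w_{k-1}`. -/
def tpos (n : ℕ) (w : Fin (n - 2) → Fin 5) (k : ℕ) : ℕ :=
  k + ∑ j ∈ Finset.univ.filter (fun j : Fin (n - 2) => (j : ℕ) + 1 < k), ((w j : ℕ))

/-- Boundary position of the bottom vertex `b_k` (`1 ≤ k ≤ n-1`) of the `k`-th shared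
vertical edge: `b_k = n + (w_1 + ⋯ + w_{n-2}) + 6 + Σ_{j ≥ k} (5 - w_j)`. -/
def bpos (n : ℕ) (w : Fin (n - 2) → Fin 5) (k : ℕ) : ℕ :=
  n + (∑ j, ((w j : ℕ))) + 6 +
    ∑ j ∈ Finset.univ.filter (fun j : Fin (n - 2) => k ≤ (j : ℕ) + 1), (5 - ((w j : ℕ)))

/-- The octagonal chain `O(w)` with `n` octagons: the outer boundary cycle on
`6n+2` vertices together with the chords `t_k b_k`, `k = 1, …, n-1`. -/
def octChain (n : ℕ) (w : Fin (n - 2) → Fin 5) : SimpleGraph (Fin (6 * n + 2)) :=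
  SimpleGraph.fromRel (fun a b =>
    ((a : ℕ) + 1 = (b : ℕ)) ∨ ((a : ℕ) = 6 * n + 1 ∧ (b : ℕ) = 0) ∨
    ∃ k, 1 ≤ k ∧ k ≤ n - 1 ∧ (a : ℕ) = tpos n w k ∧ (b : ℕ) = bpos n w k)

open Classical in
noncomputable def Lapf {V : Type} [Fintype V] (G : SimpleGraph V) (f : V → ℝ) (t : V) : ℝ :=
  ∑ s, if G.Adj t s then f t - f s else 0

theorem glap_symm {V : Type} [Fintype V] (G : SimpleGraph V) :
    (glap G).transpose = glap G := by
  classical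
  ext i j
  by_cases h : i = j
  · subst h; rfl
  · have h' : ¬ j = i := fun e => h e.symm
    simp [glap, Matrix.transpose_apply, h, h', G.adj_comm]

theorem glap_mulVec {V : Type} [Fintype V] (G : SimpleGraph V) (f : V → ℝ) :
    Matrix.mulVec (glap G) f = Lapf G f := by
  classical
  ext t
  have h1 : ∀ s, glap G t s * f s =
      (if t = s then (∑ r, if G.Adj t r then (1 : ℝ) else 0) * f t else 0)
        - (if G.Adj t s then f s else 0) := by
    intro s
    by_cases h : t = s
    · subst h
      simp [glap]
    · by_cases h2 : G.Adj t s <;> simp [glap, h, h2]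
  simp only [Matrix.mulVec, dotProduct, Lapf, h1]
  rw [Finset.sum_sub_distrib]
  simp only [Finset.sum_ite_eq, Finset.mem_univ, if_true, Finset.sum_mul]
  rw [← Finset.sum_sub_distrib]
  refine Finset.sum_congr rfl fun s _ => ?_
  split_ifs <;> simp

theorem exists_mp {n : Type} [Fintype n] (A : Matrix n n ℝ) (hA : A.transpose = A) :
    ∃ M, A.IsMoorePenroseInv M := by
  classical
  have hH : A.IsHermitian := by
    rw [Matrix.IsHermitian, Matrix.conjTranspose_eq_transpose_of_trivial, hA]
  obtain ⟨U, d, h1, h2, h3⟩ : ∃ (U : Matrix n n ℝ) (d : n → ℝ),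
      U.transpose * U = 1 ∧ U * U.transpose = 1 ∧ A = U * Matrix.diagonal d * U.transpose := by
    refine ⟨hH.eigenvectorUnitary, hH.eigenvalues, ?_, ?_, ?_⟩
    · have := Unitary.coe_star_mul_self hH.eigenvectorUnitary
      simpa [Matrix.star_eq_conjTranspose, Matrix.conjTranspose_eq_transpose_of_trivial] using this
    · have := Unitary.coe_mul_star_self hH.eigenvectorUnitary
      simpa [Matrix.star_eq_conjTranspose, Matrix.conjTranspose_eq_transpose_of_trivial] using this
    · have := hH.spectral_theorem
      rw [Unitary.conjStarAlgAut_apply] at this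
      simpa [Matrix.star_eq_conjTranspose, Matrix.conjTranspose_eq_transpose_of_trivial, Function.comp_def] using this
  have key : ∀ a b : n → ℝ, (U * Matrix.diagonal a * U.transpose) * (U * Matrix.diagonal b * U.transpose)
      = U * Matrix.diagonal (fun i => a i * b i) * U.transpose := by
    intro a b
    calc _ = U * Matrix.diagonal a * (U.transpose * U) * Matrix.diagonal b * U.transpose := by
            simp only [Matrix.mul_assoc]
      _ = _ := by rw [h1, Matrix.mul_one, Matrix.mul_assoc U, Matrix.diagonal_mul_diagonal]
  have kt : ∀ a : n → ℝ, (U * Matrix.diagonal a * U.transpose).transpose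
      = U * Matrix.diagonal a * U.transpose := by
    intro a
    simp [Matrix.transpose_mul, Matrix.mul_assoc]
  refine ⟨U * Matrix.diagonal (fun i => (d i)⁻¹) * U.transpose, ?_, ?_, ?_, ?_⟩
  · rw [h3, key, key]; congr 3; ext i
    by_cases h : d i = 0 <;> simp [h]
  · rw [h3, key, key]; congr 3; ext i
    by_cases h : d i = 0 <;> simp [h]
  · rw [h3, key, kt]
  · rw [h3, key, kt]

theorem mpinv_spec {n : Type} [Fintype n] (A : Matrix n n ℝ) (hA : A.transpose = A) :
    A.IsMoorePenroseInv (mpinv A) := by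
  have h := exists_mp A hA
  unfold mpinv
  rw [dif_pos h]
  exact h.choose_spec

theorem Lapf_bilin {V : Type} [Fintype V] [DecidableEq V] (G : SimpleGraph V) [DecidableRel G.Adj]
    (f g : V → ℝ) :
    ∑ t, g t * Lapf G f t = (∑ t, ∑ s, if G.Adj t s then (g t - g s) * (f t - f s) else 0) / 2 := by
  have h1 : ∑ t, g t * Lapf G f t = ∑ t, ∑ s, if G.Adj t s then g t * (f t - f s) else 0 := by
    refine Finset.sum_congr rfl fun t _ => ?_
    simp only [Lapf, Finset.mul_sum]
    refine Finset.sum_congr rfl fun s _ => ?_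
    split_ifs <;> simp
  have h2 : ∑ t, g t * Lapf G f t = ∑ t, ∑ s, if G.Adj t s then - g s * (f t - f s) else 0 := by
    rw [h1, Finset.sum_comm]
    refine Finset.sum_congr rfl fun t _ => Finset.sum_congr rfl fun s _ => ?_
    simp only [G.adj_comm s t]
    split_ifs
    · ring
    · rfl
  have h3 : ∑ t, g t * Lapf G f t + ∑ t, g t * Lapf G f t =
      ∑ t, ∑ s, if G.Adj t s then (g t - g s) * (f t - f s) else 0 := by
    nth_rewrite 1 [h1]
    rw [h2, ← Finset.sum_add_distrib]
    refine Finset.sum_congr rfl fun t _ => ?_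
    rw [← Finset.sum_add_distrib]
    refine Finset.sum_congr rfl fun s _ => ?_
    split_ifs
    · ring
    · simp
  linarith

theorem Lapf_symm {V : Type} [Fintype V] (G : SimpleGraph V) (f g : V → ℝ) :
    ∑ t, g t * Lapf G f t = ∑ t, f t * Lapf G g t := by
  classical
  rw [Lapf_bilin, Lapf_bilin]
  simp only [mul_comm]

theorem Lapf_nonneg {V : Type} [Fintype V] (G : SimpleGraph V) (f : V → ℝ) :
    0 ≤ ∑ t, f t * Lapf G f t := by
  classical
  rw [Lapf_bilin]
  refine div_nonneg (Finset.sum_nonneg fun t _ => Finset.sum_nonneg fun s _ => ?_) (by norm_num)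
  split_ifs
  · exact mul_self_nonneg _
  · exact le_rfl

theorem Lapf_ker {V : Type} [Fintype V] (G : SimpleGraph V) (hG : G.Connected) (f : V → ℝ)
    (hf : ∀ t, Lapf G f t = 0) (a b : V) : f a = f b := by
  classical
  have h0 : ∑ t, ∑ s, (if G.Adj t s then (f t - f s) * (f t - f s) else 0) = 0 := by
    have := Lapf_bilin G f f
    simp only [hf, mul_zero, Finset.sum_const_zero] at this
    linarith
  have hnn : ∀ t s, 0 ≤ (if G.Adj t s then (f t - f s) * (f t - f s) else 0) := by
    intro t s
    split_ifs
    · exact mul_self_nonneg _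
    · exact le_rfl
  have hadj : ∀ t s, G.Adj t s → f t = f s := by
    intro t s h
    have h1 := (Finset.sum_eq_zero_iff_of_nonneg
      (fun t _ => Finset.sum_nonneg fun s _ => hnn t s)).1 h0 t (Finset.mem_univ _)
    have h2 := (Finset.sum_eq_zero_iff_of_nonneg (fun s _ => hnn t s)).1 h1 s (Finset.mem_univ _)
    rw [if_pos h] at h2
    have := mul_self_eq_zero.1 h2
    linarith
  obtain ⟨w⟩ := hG.preconnected a b
  induction w with
  | nil => rfl
  | cons h _ ih => exact (hadj _ _ h).trans ih

theorem Lapf_sub {V : Type} [Fintype V] (G : SimpleGraph V) (f g : V → ℝ) (t : V) :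
    Lapf G (fun s => f s - g s) t = Lapf G f t - Lapf G g t := by
  classical
  simp only [Lapf, ← Finset.sum_sub_distrib]
  refine Finset.sum_congr rfl fun s _ => ?_
  split_ifs <;> ring

theorem Lapf_add {V : Type} [Fintype V] (G : SimpleGraph V) (f g : V → ℝ) (t : V) :
    Lapf G (fun s => f s + g s) t = Lapf G f t + Lapf G g t := by
  classical
  simp only [Lapf, ← Finset.sum_add_distrib]
  refine Finset.sum_congr rfl fun s _ => ?_
  split_ifs <;> ring

theorem Lapf_mul {V : Type} [Fintype V] (G : SimpleGraph V) (f : V → ℝ) (c : ℝ) (t : V) :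
    Lapf G (fun s => f s * c) t = Lapf G f t * c := by
  classical
  simp only [Lapf, Finset.sum_mul]
  refine Finset.sum_congr rfl fun s _ => ?_
  split_ifs <;> ring

/-- indicator -/
def dl {V : Type} [DecidableEq V] (a t : V) : ℝ := if t = a then 1 else 0

theorem sum_dl {V : Type} [Fintype V] [DecidableEq V] (f : V → ℝ) (a : V) :
    ∑ t, f t * dl a t = f a := by
  simp [dl]

theorem resDist_of_pot {V : Type} [Fintype V] [DecidableEq V] (G : SimpleGraph V) (f : V → ℝ)
    (a b : V) (hf : ∀ t, Lapf G f t = dl a t - dl b t) : resDist G a b = f a - f b := by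
  have hs := glap_symm G
  obtain ⟨h1, -, -, -⟩ := mpinv_spec (glap G) hs
  have e : Matrix.mulVec (glap G) f = fun t => dl a t - dl b t := by
    rw [glap_mulVec]; funext t; exact hf t
  have e1 : f ⬝ᵥ Matrix.mulVec (glap G) f = f a - f b := by
    rw [e]
    simp only [dotProduct, mul_sub, Finset.sum_sub_distrib, sum_dl]
  have e2 : f ⬝ᵥ Matrix.mulVec (glap G) f = resDist G a b := by
    conv_lhs => rw [← h1]
    rw [← Matrix.mulVec_mulVec, ← Matrix.mulVec_mulVec, Matrix.dotProduct_mulVec,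
      ← Matrix.mulVec_transpose, hs, e]
    have : ∀ t, Matrix.mulVec (mpinv (glap G)) (fun t => dl a t - dl b t) t
        = mpinv (glap G) t a - mpinv (glap G) t b := by
      intro t
      simp only [Matrix.mulVec, dotProduct, mul_sub, Finset.sum_sub_distrib, sum_dl]
    simp only [dotProduct, this]
    have h3 : ∀ t, (dl a t - dl b t) * (mpinv (glap G) t a - mpinv (glap G) t b) =
       (mpinv (glap G) t a - mpinv (glap G) t b) * dl a t -
       (mpinv (glap G) t a - mpinv (glap G) t b) * dl b t := by intro t; ring
    simp only [h3, Finset.sum_sub_distrib, sum_dl, resDist]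
    ring
  rw [← e2, e1]

theorem exists_pot {V : Type} [Fintype V] [DecidableEq V] (G : SimpleGraph V) (hG : G.Connected)
    (a b : V) : ∃ f : V → ℝ, ∀ t, Lapf G f t = dl a t - dl b t := by
  have hs := glap_symm G
  obtain ⟨h1, -, h3, -⟩ := mpinv_spec (glap G) hs
  set L := glap G with hL
  set M := mpinv L
  have h4 : L * (L * M) = L := by
    have := congrArg Matrix.transpose h1
    rw [Matrix.transpose_mul, hs, h3] at this
    exact this
  -- columns of 1 - L*M are in the kernel
  have hc : ∀ j i k, (1 - L * M) i j = (1 - L * M) k j := by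
    intro j i k
    refine Lapf_ker G hG (fun i => (1 - L * M) i j) ?_ i k
    intro t
    rw [← glap_mulVec, ← hL]
    have : (L * (1 - L * M)) t j = 0 := by
      rw [Matrix.mul_sub, h4, Matrix.mul_one, sub_self]; rfl
    exact this
  have hsym : ∀ i j, (1 - L * M) i j = (1 - L * M) j i := by
    intro i j
    have : (1 - L * M).transpose = 1 - L * M := by
      rw [Matrix.transpose_sub, h3, Matrix.transpose_one]
    exact (congrFun (congrFun this j) i)
  refine ⟨fun s => M s a - M s b, fun t => ?_⟩
  rw [← glap_mulVec, ← hL]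
  have e1 : (1 - L * M) t a = (1 - L * M) t b := by
    rw [hsym t a, hsym t b, hc t a b]
  have e2 : L.mulVec (fun s => M s a - M s b) t = (L * M) t a - (L * M) t b := by
    simp only [Matrix.mulVec, dotProduct, Matrix.mul_apply, mul_sub, Finset.sum_sub_distrib]
  rw [e2]
  simp only [Matrix.sub_apply, Matrix.one_apply] at e1
  simp only [dl]
  linarith

theorem resDist_self {V : Type} [Fintype V] (G : SimpleGraph V) (a : V) : resDist G a a = 0 := by
  unfold resDist; ring

theorem resDist_comm {V : Type} [Fintype V] (G : SimpleGraph V) (a b : V) :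
    resDist G a b = resDist G b a := by
  unfold resDist; ring

theorem resDist_nonneg {V : Type} [Fintype V] (G : SimpleGraph V) (hG : G.Connected) (a b : V) :
    0 ≤ resDist G a b := by
  classical
  obtain ⟨f, hf⟩ := exists_pot G hG a b
  rw [resDist_of_pot G f a b hf]
  have := Lapf_nonneg G f
  simp only [hf, mul_sub, Finset.sum_sub_distrib, sum_dl] at this
  exact this

/-- grounded Green function -/
noncomputable def gr {V : Type} [Fintype V] (G : SimpleGraph V) (u a b : V) : ℝ :=
  (resDist G u a + resDist G u b - resDist G a b) / 2

theorem resDist_of_green {V : Type} [Fintype V] [DecidableEq V] (G : SimpleGraph V) (u : V)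
    (X : V → V → ℝ) (hX : ∀ b t, Lapf G (fun a => X a b) t = dl b t - dl u t) (a b : V) :
    resDist G a b = X a a - X a b - X b a + X b b := by
  rw [resDist_of_pot G (fun s => X s a - X s b) a b]
  · ring
  · intro t
    rw [Lapf_sub G (fun s => X s a) (fun s => X s b), hX, hX]; ring

theorem Lapf_gr {V : Type} [Fintype V] [DecidableEq V] (G : SimpleGraph V) (hG : G.Connected)
    (u b t : V) : Lapf G (fun a => gr G u a b) t = dl b t - dl u t := by
  choose F hF using fun b => exists_pot G hG b u
  let X : V → V → ℝ := fun a b => F b a - F b u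
  have hX : ∀ b t, Lapf G (fun a => X a b) t = dl b t - dl u t := by
    intro b t
    rw [Lapf_sub G (F b) (fun _ => F b u), hF]
    simp [Lapf]
  have hXs : ∀ a b, X a b = X b a := by
    intro a b
    have := Lapf_symm G (fun s => X s a) (fun s => X s b)
    simp only [hX, mul_sub, Finset.sum_sub_distrib, sum_dl] at this
    have hu : ∀ c, X u c = 0 := by intro c; simp [X]
    rw [hu, hu] at this
    linarith
  have hu : ∀ c, X u c = 0 := by intro c; simp [X]
  have hr := resDist_of_green G u X hX
  have : (fun a => gr G u a b) = fun a => X a b := by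
    funext a
    simp only [gr, hr, hu, hXs a u, hXs b u, hXs b a]
    ring
  rw [this, hX]

open Classical in
/-- Green function extended by zero -/
noncomputable def gx {V : Type} (A : Set V) [Fintype A] (H : SimpleGraph V) (u : A) (a b : V) : ℝ :=
  if h : a ∈ A ∧ b ∈ A then gr (H.induce A) u ⟨a, h.1⟩ ⟨b, h.2⟩ else 0

theorem Lapf_gx {V : Type} [Fintype V] [DecidableEq V] (A : Set V) [Fintype A] (H : SimpleGraph V)
    (hsep : ∀ a b, H.Adj a b → (a ∈ A ↔ b ∈ A)) (hc : (H.induce A).Connected) (u : A)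
    (b : V) (hb : b ∈ A) (t : V) :
    Lapf H (fun a => gx A H u a b) t = dl b t - dl u.1 t := by
  classical
  by_cases ht : t ∈ A
  · have h1 := Lapf_gr (H.induce A) hc u ⟨b, hb⟩ ⟨t, ht⟩
    have h2 : dl (⟨b, hb⟩ : A) ⟨t, ht⟩ = dl b t := by simp [dl]
    have h3 : dl u ⟨t, ht⟩ = dl u.1 t := by simp [dl, Subtype.ext_iff]
    rw [← h2, ← h3, ← h1]
    unfold Lapf
    have h4 : ∀ s, s ∉ A → (if H.Adj t s then gx A H u t b - gx A H u s b else 0) = 0 := by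
      intro s hs
      rw [if_neg]
      intro h
      exact hs ((hsep _ _ h).1 ht)
    rw [← Finset.sum_subset (Finset.subset_univ A.toFinset)
      (fun s _ hs => h4 s (by simpa using hs))]
    rw [Finset.sum_subtype A.toFinset (p := fun s => s ∈ A) (by simp)]
    refine Finset.sum_congr rfl fun s _ => ?_
    simp [gx, ht, hb, s.2]
  · have e1 : t ≠ b := fun h => ht (h ▸ hb)
    have e2 : t ≠ u.1 := fun h => ht (h ▸ u.2)
    simp only [dl, if_neg e1, if_neg e2, sub_self]
    unfold Lapf
    refine Finset.sum_eq_zero fun s _ => ?_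
    split_ifs with h
    · have hs : s ∉ A := fun h' => ht ((hsep _ _ h).2 h')
      simp [gx, ht, hs]
    · rfl

theorem gx_zero {V : Type} (A : Set V) [Fintype A] (H : SimpleGraph V) (u : A) (a b : V)
    (h : a ∉ A ∨ b ∉ A) : gx A H u a b = 0 := by
  unfold gx
  rw [dif_neg]
  tauto

theorem gx_mem {V : Type} (A : Set V) [Fintype A] (H : SimpleGraph V) (u : A) (a b : V)
    (ha : a ∈ A) (hb : b ∈ A) : gx A H u a b = gr (H.induce A) u ⟨a, ha⟩ ⟨b, hb⟩ := by
  unfold gx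
  rw [dif_pos ⟨ha, hb⟩]

theorem gx_left {V : Type} (A : Set V) [Fintype A] (H : SimpleGraph V) (u : A) (b : V) :
    gx A H u u.1 b = 0 := by
  unfold gx
  split_ifs with h
  · simp [gr, resDist_self]
  · rfl

theorem gx_symm {V : Type} (A : Set V) [Fintype A] (H : SimpleGraph V) (u : A) (a b : V) :
    gx A H u a b = gx A H u b a := by
  by_cases h : a ∈ A ∧ b ∈ A
  · rw [gx_mem _ _ _ _ _ h.1 h.2, gx_mem _ _ _ _ _ h.2 h.1]
    unfold gr
    rw [resDist_comm (H.induce A) (⟨a, h.1⟩ : A) (⟨b, h.2⟩ : A)]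
    ring
  · rw [gx_zero _ _ _ _ _ (by tauto), gx_zero _ _ _ _ _ (by tauto)]

theorem Lapf_edges {V : Type} [Fintype V] [DecidableEq V] (G H : SimpleGraph V)
    (u x v y : V) (hux : u ≠ x) (hvy : v ≠ y) (huv : u ≠ v) (huy : u ≠ y)
    (h1 : ¬ H.Adj u x) (h2 : ¬ H.Adj v y)
    (hG : ∀ a b, G.Adj a b ↔ H.Adj a b ∨ s(a, b) = s(u, x) ∨ s(a, b) = s(v, y))
    (f : V → ℝ) (t : V) :
    Lapf G f t = Lapf H f t + (dl u t - dl x t) * (f u - f x) + (dl v t - dl y t) * (f v - f y) := by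
  classical
  have key : ∀ s, (if G.Adj t s then f t - f s else 0) = (if H.Adj t s then f t - f s else 0)
      + (f u - f x) * dl u t * dl x s + (f x - f u) * dl x t * dl u s
      + (f v - f y) * dl v t * dl y s + (f y - f v) * dl y t * dl v s := by
    intro s
    have h1' : ¬ H.Adj x u := fun h => h1 h.symm
    have h2' : ¬ H.Adj y v := fun h => h2 h.symm
    by_cases c1 : t = u ∧ s = x
    · obtain ⟨rfl, rfl⟩ := c1
      have : G.Adj t s := (hG _ _).2 (Or.inr (Or.inl rfl))
      simp [this, h1, dl, hux, huv, huy]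
    by_cases c2 : t = x ∧ s = u
    · obtain ⟨rfl, rfl⟩ := c2
      have : G.Adj t s := (hG _ _).2 (Or.inr (Or.inl Sym2.eq_swap))
      simp [this, h1', dl, hux.symm, huv, huy]
    have n12 : (dl u t * dl x s : ℝ) = 0 ∧ (dl x t * dl u s : ℝ) = 0 := by
      simp only [dl, mul_eq_zero, ite_eq_right_iff, one_ne_zero, imp_false]; tauto
    by_cases c3 : t = v ∧ s = y
    · obtain ⟨rfl, rfl⟩ := c3
      have : G.Adj t s := (hG _ _).2 (Or.inr (Or.inr rfl))
      simp only [mul_assoc, n12]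
      simp [this, h2, dl, hvy]
    by_cases c4 : t = y ∧ s = v
    · obtain ⟨rfl, rfl⟩ := c4
      have : G.Adj t s := (hG _ _).2 (Or.inr (Or.inr Sym2.eq_swap))
      simp only [mul_assoc, n12]
      simp [this, h2', dl, hvy.symm]
    have n34 : (dl v t * dl y s : ℝ) = 0 ∧ (dl y t * dl v s : ℝ) = 0 := by
      simp only [dl, mul_eq_zero, ite_eq_right_iff, one_ne_zero, imp_false]; tauto
    have : G.Adj t s ↔ H.Adj t s := by
      rw [hG]; simp only [Sym2.eq_iff]; tauto
    simp only [mul_assoc, n12, n34, this]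
    simp
  unfold Lapf
  simp only [key, Finset.sum_add_distrib, sum_dl]
  have : ∀ c a, ∑ s, c * dl a s = c := fun c a => sum_dl (fun _ : V => c) a
  ring

theorem resDist_glue {V : Type} [Fintype V] [DecidableEq V] (G H : SimpleGraph V)
    (A B : Set V) [Fintype A] [Fintype B] (hpart : ∀ t, t ∈ A ↔ t ∉ B)
    (u v : A) (x y : B) (huv : u.1 ≠ v.1)
    (hsep : ∀ a b, H.Adj a b → (a ∈ A ↔ b ∈ A))
    (hA : (H.induce A).Connected) (hB : (H.induce B).Connected)
    (hG : ∀ a b, G.Adj a b ↔ H.Adj a b ∨ s(a, b) = s(u.1, x.1) ∨ s(a, b) = s(v.1, y.1))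
    (D : ℝ) (hD : D = resDist (H.induce A) u v + resDist (H.induce B) x y + 2) :
    (∀ a b : A, resDist G a b = resDist (H.induce A) a b -
      (gr (H.induce A) u a v - gr (H.induce A) u b v) ^ 2 / D) ∧
    (∀ a b : B, resDist G a b = resDist (H.induce B) a b -
      (gr (H.induce B) x a y - gr (H.induce B) x b y) ^ 2 / D) ∧
    (∀ (a : A) (b : B), resDist G a b =
      resDist (H.induce A) u a + resDist (H.induce B) x b + 1 -
      (gr (H.induce A) u a v + gr (H.induce B) x b y + 1) ^ 2 / D) := by
  classical
  have hD0 : D ≠ 0 := by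
    have := resDist_nonneg _ hA u v
    have := resDist_nonneg _ hB x y
    rw [hD]; positivity
  have hsepB : ∀ a b, H.Adj a b → (a ∈ B ↔ b ∈ B) := by
    intro a b h
    have := hsep a b h
    rw [hpart, hpart] at this
    tauto
  have nA : ∀ b : B, b.1 ∉ A := fun b h => (hpart _).1 h b.2
  have nB : ∀ a : A, a.1 ∉ B := fun a h => (hpart _).1 a.2 h
  have ne : ∀ (a : A) (b : B), a.1 ≠ b.1 := fun a b h => nA b (h ▸ a.2)
  have nadj : ∀ (a : A) (b : B), ¬ H.Adj a.1 b.1 := fun a b h => nA b ((hsep _ _ h).1 a.2)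
  let i : V → ℝ := fun a => if a ∈ B then 1 else 0
  have iA : ∀ a : A, i a.1 = 0 := fun a => if_neg (nB a)
  have iB : ∀ a : B, i a.1 = 1 := fun a => if_pos a.2
  have Li : ∀ t, Lapf H i t = 0 := by
    intro t
    unfold Lapf
    refine Finset.sum_eq_zero fun s _ => ?_
    split_ifs with h
    · simp only [i, hsepB _ _ h, sub_self]
    · rfl
  let Y : V → V → ℝ := fun a b => gx A H u a b + gx B H x a b + i a * i b
  have Ysym : ∀ a b, Y a b = Y b a := by
    intro a b
    simp only [Y, gx_symm A H u a b, gx_symm B H x a b, mul_comm]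
  have YAA : ∀ a b : A, Y a b = gr (H.induce A) u a b := by
    intro a b
    simp only [Y, gx_zero B H x a b (Or.inl (nB a)), gx_mem A H u a b a.2 b.2, iA]
    simp
  have YBB : ∀ a b : B, Y a b = gr (H.induce B) x a b + 1 := by
    intro a b
    simp only [Y, gx_zero A H u a b (Or.inl (nA a)), gx_mem B H x a b a.2 b.2, iB]
    simp
  have YAB : ∀ (a : A) (b : B), Y a b = 0 := by
    intro a b
    simp only [Y, gx_zero A H u a b (Or.inr (nA b)), gx_zero B H x a b (Or.inl (nB a)), iA]
    simp
  have YBA : ∀ (a : A) (b : B), Y b a = 0 := by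
    intro a b
    rw [Ysym, YAB]
  have LY : ∀ b t, Lapf H (fun a => Y a b) t + (dl u.1 t - dl x.1 t) * (Y u b - Y x b)
      = dl b t - dl u.1 t := by
    intro b t
    have e : Lapf H (fun a => Y a b) t = Lapf H (fun a => gx A H u a b) t
        + Lapf H (fun a => gx B H x a b) t := by
      rw [Lapf_add H (fun a => gx A H u a b + gx B H x a b) (fun a => i a * i b),
        Lapf_add H (fun a => gx A H u a b) (fun a => gx B H x a b), Lapf_mul H i (i b), Li]
      ring
    have z : Lapf H (fun _ => (0 : ℝ)) t = 0 := by simp [Lapf]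
    rw [e]
    by_cases hb : b ∈ B
    · lift b to B using hb
      rw [YAB, YBB]
      simp only [gx_zero A H u _ b.1 (Or.inr (nA b))]
      rw [z, Lapf_gx B H hsepB hB x b b.2]
      have : gr (H.induce B) x x b = 0 := by simp [gr, resDist_self]
      rw [this]; ring
    · have hb' : b ∈ A := (hpart b).2 hb
      lift b to A using hb'
      rw [YBA, YAA]
      simp only [gx_zero B H x _ b.1 (Or.inr (nB b))]
      rw [z, Lapf_gx A H hsep hA u b b.2]
      have : gr (H.induce A) u u b = 0 := by simp [gr, resDist_self]
      rw [this]; ring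
  let h : V → ℝ := fun a => Y a v - Y a y
  have hh : h v - h y = D - 1 := by
    simp only [h, YAA, YBB, YAB, YBA, gr, resDist_self, hD]
    ring
  have Lh : ∀ t, Lapf H h t + (dl u.1 t - dl x.1 t) * (h u - h x) = dl v.1 t - dl y.1 t := by
    intro t
    have := LY v t
    have := LY y t
    rw [Lapf_sub H (fun a => Y a v) (fun a => Y a y)]
    simp only [h]
    linarith
  let X : V → V → ℝ := fun a b => Y a b - h a * (h b / D)
  have LX : ∀ b t, Lapf G (fun a => X a b) t = dl b t - dl u.1 t := by
    intro b t
    rw [Lapf_edges G H u x v y (ne _ _) (ne _ _) huv (ne _ _) (nadj _ _) (nadj _ _) hG,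
      Lapf_sub H (fun a => Y a b) (fun a => h a * (h b / D)), Lapf_mul H h (h b / D)]
    have e1 := LY b t
    have e2 := Lh t
    have e3 : Y v b - Y y b = h b := by
      simp only [h]; rw [Ysym v b, Ysym y b]
    have e4 : X v b - X y b = h b / D := by
      have : X v b - X y b = (Y v b - Y y b) - (h v - h y) * (h b / D) := by
        simp only [X]; ring
      rw [this, e3, hh]
      field_simp
      ring
    have e5 : X u b - X x b = (Y u b - Y x b) - (h u - h x) * (h b / D) := by
      simp only [X]; ring
    rw [e4, e5]
    linear_combination e1 - (h b / D) * e2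
  have hr : ∀ a b, resDist G a b = Y a a - Y a b - Y b a + Y b b - (h a - h b) ^ 2 / D := by
    intro a b
    rw [resDist_of_green G u.1 X LX]
    simp only [X]
    ring
  refine ⟨fun a b => ?_, fun a b => ?_, fun a b => ?_⟩
  · rw [hr]
    simp only [h, YAA, YAB, sub_zero]
    congr 1
    simp only [gr, resDist_self, resDist_comm _ b a]
    ring
  · rw [hr]
    simp only [h, YBB, YBA]
    congr 1
    · simp only [gr, resDist_self, resDist_comm _ b a]
      ring
    · ring
  · rw [hr]
    simp only [h, YBB, YBA, YAB, YAA]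
    congr 1
    · simp only [gr, resDist_self]
      ring
    · ring

theorem resSum_eq {V : Type} [Fintype V] [DecidableEq V] (G : SimpleGraph V) (a : V) :
    resSum G a = ∑ b, resDist G a b := by
  unfold resSum
  rw [← Finset.add_sum_erase _ _ (Finset.mem_univ a), resDist_self, zero_add]

theorem sum_dite_set {V : Type} [Fintype V] (A : Set V) [Fintype A] [DecidablePred (· ∈ A)] (F : A → ℝ) :
    (∑ a, if h : a ∈ A then F ⟨a, h⟩ else 0) = ∑ a : A, F a := by
  classical
  rw [← Finset.sum_subset (Finset.subset_univ A.toFinset)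
      (fun s _ hs => dif_neg (by simpa using hs))]
  rw [Finset.sum_subtype A.toFinset (p := fun s => s ∈ A) (by simp)]
  refine Finset.sum_congr rfl fun s _ => ?_
  simp

/-- Yang–Klein `S,T`-isomer comparison. If `{ux, vy}` is an edge cut of
the connected graph `S` whose deletion leaves exactly the two connected components `A`
(containing `u, v`) and `B` (containing `x, y`), and `T` is obtained from `S` by deleting
`ux, vy` and adding `uy, vx`, then
`Kf(S) - Kf(T) = (r_A(u) - r_A(v))·(r_B(y) - r_B(x)) / (r_A(u,v) + r_B(x,y) + 2)`. -/
theorem ST_isomer_kirchhoff_difference {V : Type} [Fintype V] [DecidableEq V]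
    (S : SimpleGraph V) (hS : S.Connected) (u v x y : V) (huv : u ≠ v) (hxy : x ≠ y)
    (hux : S.Adj u x) (hvy : S.Adj v y)
    (A B : Set V) [Fintype ↥A] [Fintype ↥B]
    (hu : u ∈ A) (hv : v ∈ A) (hx : x ∈ B) (hy : y ∈ B)
    (hpart : ∀ t, t ∈ A ↔ t ∉ B)
    (hAconn : ((S.deleteEdges {s(u, x), s(v, y)}).induce A).Connected)
    (hBconn : ((S.deleteEdges {s(u, x), s(v, y)}).induce B).Connected)
    (hcut : ∀ a ∈ A, ∀ b ∈ B, ¬ (S.deleteEdges {s(u, x), s(v, y)}).Adj a b)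
    (T : SimpleGraph V)
    (hT : T = SimpleGraph.fromRel (fun a b =>
      (S.deleteEdges {s(u, x), s(v, y)}).Adj a b ∨ (a = u ∧ b = y) ∨ (a = v ∧ b = x))) :
    kirchhoff S - kirchhoff T =
      (resSum ((S.deleteEdges {s(u, x), s(v, y)}).induce A) ⟨u, hu⟩ -
        resSum ((S.deleteEdges {s(u, x), s(v, y)}).induce A) ⟨v, hv⟩) *
      (resSum ((S.deleteEdges {s(u, x), s(v, y)}).induce B) ⟨y, hy⟩ -
        resSum ((S.deleteEdges {s(u, x), s(v, y)}).induce B) ⟨x, hx⟩) /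
      (resDist ((S.deleteEdges {s(u, x), s(v, y)}).induce A) ⟨u, hu⟩ ⟨v, hv⟩ +
        resDist ((S.deleteEdges {s(u, x), s(v, y)}).induce B) ⟨x, hx⟩ ⟨y, hy⟩ + 2) := by
  classical
  set H := S.deleteEdges {s(u, x), s(v, y)} with hH
  have nA : ∀ b ∈ B, b ∉ A := fun b hb h => (hpart _).1 h hb
  have ne : ∀ a ∈ A, ∀ b ∈ B, a ≠ b := fun a ha b hb h => nA b hb (h ▸ ha)
  have hsep : ∀ a b, H.Adj a b → (a ∈ A ↔ b ∈ A) := by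
    intro a b h
    by_cases ha : a ∈ A <;> by_cases hb : b ∈ A
    · tauto
    · exact absurd h (hcut a ha b (by have := hpart b; tauto))
    · exact absurd h.symm (hcut b hb a (by have := hpart a; tauto))
    · tauto
  have hS' : ∀ a b, S.Adj a b ↔ H.Adj a b ∨ s(a, b) = s(u, x) ∨ s(a, b) = s(v, y) := by
    intro a b
    rw [hH, SimpleGraph.deleteEdges_adj]
    simp only [Set.mem_insert_iff, Set.mem_singleton_iff]
    constructor
    · tauto
    · rintro (h | h | h)
      · exact h.1
      · rw [← SimpleGraph.mem_edgeSet, h]; exact hux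
      · rw [← SimpleGraph.mem_edgeSet, h]; exact hvy
  have hT' : ∀ a b, T.Adj a b ↔ H.Adj a b ∨ s(a, b) = s(u, y) ∨ s(a, b) = s(v, x) := by
    intro a b
    rw [hT, SimpleGraph.fromRel_adj]
    simp only [Sym2.eq_iff, H.adj_comm b a]
    have e1 := ne u hu y hy
    have e2 := ne v hv x hx
    constructor
    · tauto
    · rintro (h | (⟨rfl, rfl⟩ | ⟨rfl, rfl⟩) | (⟨rfl, rfl⟩ | ⟨rfl, rfl⟩))
      · exact ⟨h.ne, by tauto⟩
      · exact ⟨e1, by tauto⟩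
      · exact ⟨e1.symm, by tauto⟩
      · exact ⟨e2, by tauto⟩
      · exact ⟨e2.symm, by tauto⟩
  set D := resDist (H.induce A) ⟨u, hu⟩ ⟨v, hv⟩ + resDist (H.induce B) ⟨x, hx⟩ ⟨y, hy⟩ + 2 with hD
  have hD0 : D ≠ 0 := by
    have := resDist_nonneg _ hAconn ⟨u, hu⟩ ⟨v, hv⟩
    have := resDist_nonneg _ hBconn ⟨x, hx⟩ ⟨y, hy⟩
    rw [hD]; positivity
  obtain ⟨s1, s2, s3⟩ := resDist_glue S H A B hpart ⟨u, hu⟩ ⟨v, hv⟩ ⟨x, hx⟩ ⟨y, hy⟩ huv hsep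
    hAconn hBconn hS' D hD
  obtain ⟨t1, t2, t3⟩ := resDist_glue T H A B hpart ⟨u, hu⟩ ⟨v, hv⟩ ⟨y, hy⟩ ⟨x, hx⟩ huv hsep
    hAconn hBconn hT' D (by rw [hD, resDist_comm _ (⟨x, hx⟩ : B)])
  let fA : A → ℝ := fun a => resDist (H.induce A) ⟨u, hu⟩ a - resDist (H.induce A) ⟨v, hv⟩ a
  let fB : B → ℝ := fun b => resDist (H.induce B) ⟨y, hy⟩ b - resDist (H.induce B) ⟨x, hx⟩ b
  let α : V → ℝ := fun a => if h : a ∈ A then fA ⟨a, h⟩ else 0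
  let β : V → ℝ := fun b => if h : b ∈ B then fB ⟨b, h⟩ else 0
  have hα : ∑ a, α a = resSum (H.induce A) ⟨u, hu⟩ - resSum (H.induce A) ⟨v, hv⟩ := by
    rw [resSum_eq, resSum_eq, ← Finset.sum_sub_distrib]
    exact sum_dite_set A fA
  have hβ : ∑ a, β a = resSum (H.induce B) ⟨y, hy⟩ - resSum (H.induce B) ⟨x, hx⟩ := by
    rw [resSum_eq, resSum_eq, ← Finset.sum_sub_distrib]
    exact sum_dite_set B fB
  have αA : ∀ a : A, α a = fA a := fun a => dif_pos a.2
  have αB : ∀ a : B, α a = 0 := fun a => dif_neg (nA a a.2)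
  have βB : ∀ a : B, β a = fB a := fun a => dif_pos a.2
  have βA : ∀ a : A, β a = 0 := fun a => dif_neg (fun h => nA a h a.2)
  have mix : ∀ (a : A) (b : B), resDist S a b - resDist T a b = fA a * fB b / D := by
    intro a b
    rw [s3, t3]
    simp only [gr, fA, fB]
    rw [resDist_comm _ b ⟨x, hx⟩, resDist_comm _ b ⟨y, hy⟩, resDist_comm _ a ⟨v, hv⟩,
      resDist_comm _ (⟨y, hy⟩ : B) ⟨x, hx⟩]
    field_simp
    rw [hD]
    ring
  have key : ∀ a b, resDist S a b - resDist T a b = (α a * β b + α b * β a) / D := by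
    intro a b
    by_cases ha : a ∈ A <;> by_cases hb : b ∈ A
    · lift a to A using ha
      lift b to A using hb
      rw [s1, t1, βA, βA]; ring
    · have hb' : b ∈ B := by have := hpart b; tauto
      lift a to A using ha
      lift b to B using hb'
      rw [mix, αA, βB, αB]; ring
    · have ha' : a ∈ B := by have := hpart a; tauto
      lift a to B using ha'
      lift b to A using hb
      rw [resDist_comm S, resDist_comm T, mix, αA, βB, αB]; ring
    · have ha' : a ∈ B := by have := hpart a; tauto
      have hb' : b ∈ B := by have := hpart b; tauto
      lift a to B using ha'
      lift b to B using hb'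
      rw [s2, t2, αB, αB]
      simp only [gr]
      rw [resDist_comm _ b ⟨x, hx⟩, resDist_comm _ b ⟨y, hy⟩,
        resDist_comm _ a ⟨x, hx⟩, resDist_comm _ a ⟨y, hy⟩]
      ring
  have fin : kirchhoff S - kirchhoff T = (∑ a, α a) * (∑ b, β b) / D := by
    have : kirchhoff S - kirchhoff T = (∑ a, ∑ b, (resDist S a b - resDist T a b)) / 2 := by
      simp only [kirchhoff, Finset.sum_sub_distrib]; ring
    rw [this]
    simp only [key, ← Finset.sum_div, Finset.sum_add_distrib, ← Finset.mul_sum, ← Finset.sum_mul]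
    ring
  rw [fin, hα, hβ]
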